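/- Let m be a positive integer and let b_1, …, b_m be nonzero real numbers and α_1, …, α_m real numbers such that the α_j are distinct and satisfy 0 < α_j < 1/2 for all j. Suppose in addition that none of the differences α_i − α_j with i ≠ j is rational and none of the sums α_i + α_j (including i = j) is rational. Then inf_{k∈ℤ} ∑_{j=1}^m b_j cos(2π α_j k) < −(log(2m)/(2π⁴)) min_j |b_j|. -/

import Mathlib

open Real Finset

/-- normalised mean over a period -/
noncomputable def cavg {E : Type*} [NormedAddCommGroup E] [NormedSpace ℝ E] (F : ℝ → E) : E :=
  (2 * Real.pi)⁻¹ • ∫ θ in (0 : ℝ)..(2 * Real.pi), F θ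

/-- point on the unit circle -/
noncomputable def cpt (θ : ℝ) : ℂ := Complex.exp (θ * Complex.I)

/-- the character of index n -/
noncomputable def cchar (n : ℤ) (θ : ℝ) : ℂ := Complex.exp (n * (θ * Complex.I))

@[fun_prop] lemma cpt_continuous : Continuous cpt := by unfold cpt; fun_prop
@[fun_prop] lemma cchar_continuous (n : ℤ) : Continuous (cchar n) := by unfold cchar; fun_prop

lemma cchar_add (m n : ℤ) (θ : ℝ) : cchar (m + n) θ = cchar m θ * cchar n θ := by
  simp only [cchar, ← Complex.exp_add]; push_cast; ring_nf

lemma cchar_zero (θ : ℝ) : cchar 0 θ = 1 := by simp [cchar]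

lemma cchar_norm (n : ℤ) (θ : ℝ) : ‖cchar n θ‖ = 1 := by
  have : cchar n θ = Complex.exp (((n * θ : ℝ) : ℂ) * Complex.I) := by
    simp only [cchar]; push_cast; ring_nf
  rw [this, Complex.norm_exp_ofReal_mul_I]

lemma cchar_conj (n : ℤ) (θ : ℝ) : (starRingEnd ℂ) (cchar n θ) = cchar (-n) θ := by
  simp only [cchar, ← Complex.exp_conj]; simp

lemma cchar_nat (n : ℕ) (θ : ℝ) : cchar n θ = cpt θ ^ n := by
  simp only [cchar, cpt, ← Complex.exp_nat_mul]; simp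

lemma cchar_periodic (n : ℤ) : Function.Periodic (cchar n) (2 * Real.pi) := by
  intro θ
  simp only [cchar]
  rw [Complex.exp_eq_exp_iff_exists_int]
  exact ⟨n, by push_cast; ring⟩

section
variable {E : Type*} [NormedAddCommGroup E] [NormedSpace ℝ E]

lemma cavg_add {F G : ℝ → E} (hF : Continuous F) (hG : Continuous G) :
    cavg (fun θ => F θ + G θ) = cavg F + cavg G := by
  unfold cavg
  rw [intervalIntegral.integral_add (hF.intervalIntegrable _ _) (hG.intervalIntegrable _ _),
    smul_add]

lemma cavg_sub {F G : ℝ → E} (hF : Continuous F) (hG : Continuous G) :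
    cavg (fun θ => F θ - G θ) = cavg F - cavg G := by
  unfold cavg
  rw [intervalIntegral.integral_sub (hF.intervalIntegrable _ _) (hG.intervalIntegrable _ _),
    smul_sub]

lemma cavg_sum {ι : Type*} (s : Finset ι) {F : ι → ℝ → E} (hF : ∀ i ∈ s, Continuous (F i)) :
    cavg (fun θ => ∑ i ∈ s, F i θ) = ∑ i ∈ s, cavg (F i) := by
  unfold cavg
  rw [intervalIntegral.integral_finsetSum (fun i hi => (hF i hi).intervalIntegrable _ _),
    Finset.smul_sum]

lemma cavg_norm_le (F : ℝ → E) : ‖cavg F‖ ≤ cavg (fun θ => ‖F θ‖) := by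
  unfold cavg
  rw [norm_smul, smul_eq_mul, Real.norm_of_nonneg (by positivity)]
  gcongr
  exact intervalIntegral.norm_integral_le_integral_norm (by positivity)

end

lemma cavg_mul_left (c : ℂ) (F : ℝ → ℂ) : cavg (fun θ => c * F θ) = c * cavg F := by
  unfold cavg
  rw [intervalIntegral.integral_const_mul, mul_smul_comm]

lemma cavg_mul_left_real (c : ℝ) (F : ℝ → ℝ) : cavg (fun θ => c * F θ) = c * cavg F := by
  unfold cavg
  rw [intervalIntegral.integral_const_mul, mul_smul_comm]

lemma cavg_const (c : ℝ) : cavg (fun _ => c) = c := by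
  unfold cavg
  have := Real.pi_pos
  simp; field_simp

lemma cavg_mono {F G : ℝ → ℝ} (hF : Continuous F) (hG : Continuous G) (h : ∀ θ, F θ ≤ G θ) :
    cavg F ≤ cavg G := by
  unfold cavg
  simp only [smul_eq_mul]
  gcongr
  exact intervalIntegral.integral_mono (by positivity) (hF.intervalIntegrable _ _)
    (hG.intervalIntegrable _ _) h

lemma cavg_re {F : ℝ → ℂ} (hF : Continuous F) : cavg (fun θ => (F θ).re) = (cavg F).re := by
  unfold cavg
  have := intervalIntegral.intervalIntegral_re (𝕜 := ℂ) (hF.intervalIntegrable 0 (2 * Real.pi) (μ := MeasureTheory.volume))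
  simp only [RCLike.re_eq_complex_re] at this
  rw [this, Complex.smul_re]

lemma cavg_conj {F : ℝ → ℂ} : cavg (fun θ => (starRingEnd ℂ) (F θ)) = (starRingEnd ℂ) (cavg F) := by
  unfold cavg
  rw [intervalIntegral.integral_of_le (by positivity), intervalIntegral.integral_of_le (by positivity),
    integral_conj]
  simp [Complex.real_smul]
  exact Or.inl (map_ofNat _ 2).symm

lemma cavg_analytic {g : ℂ → ℂ} (hg : Differentiable ℂ g) : cavg (fun θ => g (cpt θ)) = g 0 := by
  rw [← DiffContOnCl.circleAverage (f := g) (c := 0) (R := 1) hg.diffContOnCl, Real.circleAverage_def]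
  simp [cavg, cpt, circleMap]

lemma cavg_char_analytic {g : ℂ → ℂ} (hg : Differentiable ℂ g) {n : ℤ} (hn : 0 < n) :
    cavg (fun θ => cchar n θ * g (cpt θ)) = 0 := by
  lift n to ℕ using hn.le
  have := cavg_analytic (g := fun z => z ^ n * g z) (by fun_prop)
  simp only [cchar_nat]
  rw [this, zero_pow (by omega), zero_mul]

lemma cavg_char {n : ℤ} (hn : n ≠ 0) : cavg (cchar n) = 0 := by
  have pos : ∀ n : ℤ, 0 < n → cavg (cchar n) = 0 := by
    intro n hn
    simpa using cavg_char_analytic (g := fun _ => 1) (by fun_prop) hn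
  rcases lt_or_gt_of_ne hn with h | h
  · have h1 := pos (-n) (by omega)
    have h2 := cavg_conj (F := cchar (-n))
    simp only [cchar_conj, neg_neg, h1] at h2
    simpa using h2
  · exact pos n h

lemma cavg_char_zero : cavg (cchar 0) = 1 := by
  have := cavg_analytic (g := fun _ => 1) (by fun_prop)
  rw [show cchar 0 = fun _ => 1 from funext cchar_zero]
  exact this

lemma norm_exp_neg_sub_one_le {z : ℂ} (hz : 0 ≤ z.re) : ‖Complex.exp (-z) - 1‖ ≤ ‖z‖ := by
  have hs : Convex ℝ {w : ℂ | w.re ≤ 0} := convex_halfSpace_re_le 0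
  have := hs.norm_image_sub_le_of_norm_deriv_le (𝕜 := ℂ) (f := Complex.exp) (C := 1) (x := 0) (y := -z)
    (fun x _ => Complex.differentiable_exp x)
    (fun x hx => by
      rw [Complex.deriv_exp, Complex.norm_exp]
      exact Real.exp_le_one_iff.mpr hx) (by simp) (by simpa using hz)
  simpa using this

/-- approximation of continuous periodic functions by real parts of entire functions -/
lemma exists_analytic_approx {φ : ℝ → ℝ} (hφ : Continuous φ) (hp : Function.Periodic φ (2 * Real.pi))
    {δ : ℝ} (hδ : 0 < δ) :
    ∃ g : ℂ → ℂ, Differentiable ℂ g ∧ (g 0).im = 0 ∧ ∀ θ, |(g (cpt θ)).re - φ θ| ≤ δ := by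
  have : Fact (0 < 2 * Real.pi) := ⟨by positivity⟩
  let Φ : C(AddCircle (2 * Real.pi), ℂ) :=
    ⟨fun x => ((hp.lift x : ℝ) : ℂ), Complex.continuous_ofReal.comp
      (by
        refine continuous_coinduced_dom.mpr ?_
        exact hφ)⟩
  have hΦ : Φ ∈ (Submodule.span ℂ (Set.range <| @fourier (2 * Real.pi))).topologicalClosure := by
    rw [span_fourier_closure_eq_top]; trivial
  rw [← SetLike.mem_coe, Submodule.topologicalClosure_coe, Metric.mem_closure_iff] at hΦ
  obtain ⟨u, hu, hd⟩ := hΦ δ hδ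
  have key : ∀ c : ℂ, ∃ g : ℂ → ℂ, Differentiable ℂ g ∧
      ∀ θ : ℝ, (c * u (θ : AddCircle (2 * Real.pi))).re = (g (cpt θ)).re := by
    rw [SetLike.mem_coe] at hu
    clear hd
    induction hu using Submodule.span_induction with
    | mem x hx =>
      obtain ⟨n, rfl⟩ := hx
      intro c
      have hf : ∀ θ : ℝ, fourier n (θ : AddCircle (2 * Real.pi)) = cchar n θ := by
        intro θ
        rw [fourier_coe_apply, cchar]
        congr 1
        have : (Real.pi : ℂ) ≠ 0 := by exact_mod_cast Real.pi_ne_zero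
        push_cast
        field_simp
      simp only [hf]
      rcases le_total 0 n with h | h
      · lift n to ℕ using h
        exact ⟨fun z => c * z ^ n, by fun_prop, fun θ => by rw [cchar_nat]⟩
      · obtain ⟨k, hk⟩ := Int.eq_ofNat_of_zero_le (show 0 ≤ -n by omega)
        refine ⟨fun z => (starRingEnd ℂ) c * z ^ k, by fun_prop, fun θ => ?_⟩
        show _ = ((starRingEnd ℂ) c * cpt θ ^ k).re
        rw [← cchar_nat, ← hk, ← cchar_conj, ← map_mul, Complex.conj_re]
    | zero => exact fun c => ⟨fun _ => 0, by fun_prop, by simp⟩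
    | add x y _ _ hx hy =>
      intro c
      obtain ⟨g, hg, hg'⟩ := hx c
      obtain ⟨k, hk, hk'⟩ := hy c
      exact ⟨fun z => g z + k z, by fun_prop, fun θ => by simp [← hg', ← hk', mul_add]⟩
    | smul a x _ hx =>
      intro c
      obtain ⟨g, hg, hg'⟩ := hx (c * a)
      exact ⟨g, hg, fun θ => by rw [← hg']; simp [mul_assoc]⟩
  obtain ⟨g, hg, hg'⟩ := key 1
  refine ⟨fun z => g z - ((g 0).im : ℂ) * Complex.I, by fun_prop, by simp, fun θ => ?_⟩
  have h1 := (ContinuousMap.dist_apply_le_dist (f := Φ) (g := u) (θ : AddCircle (2 * Real.pi))).trans hd.le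
  have h2 : Φ (θ : AddCircle (2 * Real.pi)) = (φ θ : ℂ) := by
    simp [Φ, Function.Periodic.lift_coe]
  rw [h2, dist_comm, dist_eq_norm] at h1
  have h3 := (Complex.abs_re_le_norm _).trans h1
  have h4 := hg' θ
  rw [one_mul] at h4
  simpa [h4] using h3

lemma exists_majorant {f : ℝ → ℂ} (hf : Continuous f) (hp : Function.Periodic f (2 * Real.pi))
    (h1 : ∀ θ, ‖f θ‖ ≤ 1) {s : ℝ} (hs : 0 < s) (hs1 : s ≤ 1) (hfs : cavg (fun θ => ‖f θ‖ ^ 2) ≤ s) :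
    ∃ g : ℂ → ℂ, Differentiable ℂ g ∧ (∀ θ, ‖f θ‖ ≤ (g (cpt θ)).re) ∧
      cavg (fun θ => ‖g (cpt θ)‖ ^ 2) ≤ 4 * s := by
  obtain ⟨g, hg, hg0, hga⟩ := exists_analytic_approx (φ := fun θ => ‖f θ‖ + s / 8) (by fun_prop)
    (by intro θ; simp [hp θ]) (δ := s / 8) (by positivity)
  have hgc : Continuous g := hg.continuous
  refine ⟨g, hg, fun θ => by have := abs_le.mp (hga θ); linarith, ?_⟩
  have hre : cavg (fun θ => (g (cpt θ)).re ^ 2) ≤ cavg (fun θ => ‖f θ‖ ^ 2 + s) := by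
    refine cavg_mono (by fun_prop) (by fun_prop) fun θ => ?_
    have h2 := abs_le.mp (hga θ)
    have h3 := h1 θ
    have h4 := norm_nonneg (f θ)
    nlinarith
  rw [cavg_add (by fun_prop) (by fun_prop), cavg_const] at hre
  have hsq := cavg_analytic (g := fun z => g z ^ 2) (by fun_prop)
  have hsq2 : cavg (fun θ => (g (cpt θ) ^ 2).re) = (g 0).re ^ 2 := by
    rw [cavg_re (by fun_prop), hsq, sq, Complex.mul_re, hg0]; ring
  have e : (fun θ => ‖g (cpt θ)‖ ^ 2) = fun θ => 2 * (g (cpt θ)).re ^ 2 - (g (cpt θ) ^ 2).re := by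
    funext θ
    rw [Complex.sq_norm, Complex.normSq_apply, sq (g (cpt θ)), Complex.mul_re]; ring
  rw [e, cavg_sub (by fun_prop) (by fun_prop), cavg_mul_left_real, hsq2]
  nlinarith [sq_nonneg (g 0).re]

lemma sum_exp_bounded (f : ℕ → ℝ → ℂ) (g : ℕ → ℂ → ℂ) (h1 : ∀ j θ, ‖f j θ‖ ≤ 1)
    (h2 : ∀ j θ, ‖f j θ‖ ≤ (g j (cpt θ)).re) (J : ℕ) (θ : ℝ) :
    ‖∑ j ∈ Finset.range J, f j θ *
      Complex.exp (-(3 / 16 * ∑ i ∈ Finset.Ico (j + 1) J, g i (cpt θ)))‖ ≤ 19 / 3 := by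
  induction J with
  | zero => simp; norm_num
  | succ J ih =>
    have e : ∑ j ∈ Finset.range (J + 1), f j θ *
          Complex.exp (-(3 / 16 * ∑ i ∈ Finset.Ico (j + 1) (J + 1), g i (cpt θ))) =
        (∑ j ∈ Finset.range J, f j θ *
          Complex.exp (-(3 / 16 * ∑ i ∈ Finset.Ico (j + 1) J, g i (cpt θ)))) *
          Complex.exp (-(3 / 16 * g J (cpt θ))) + f J θ := by
      rw [Finset.sum_range_succ, Finset.sum_mul]
      congr 1
      · refine Finset.sum_congr rfl fun j hj => ?_
        rw [Finset.mem_range] at hj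
        rw [Finset.sum_Ico_succ_top (by omega), mul_assoc, ← Complex.exp_add]
        congr 2
        ring
      · simp
    rw [e]
    set u := ‖f J θ‖ with hu
    have hu0 : 0 ≤ u := norm_nonneg _
    have hu1 : u ≤ 1 := h1 J θ
    have hexp : ‖Complex.exp (-(3 / 16 * g J (cpt θ)))‖ ≤ 1 / (1 + 3 / 16 * u) := by
      rw [Complex.norm_exp]
      have hre : (-(3 / 16 * g J (cpt θ))).re = -(3 / 16 * (g J (cpt θ)).re) := by
        simp [Complex.mul_re]
      rw [hre, Real.exp_neg, one_div]
      have h3 := h2 J θ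
      have h4 := Real.add_one_le_exp (3 / 16 * (g J (cpt θ)).re)
      refine inv_anti₀ (by positivity) ?_
      linarith
    calc _ ≤ 19 / 3 * (1 / (1 + 3 / 16 * u)) + u := by
          refine (norm_add_le _ _).trans ?_
          rw [norm_mul]
          gcongr
      _ ≤ 19 / 3 := by
          have : 0 < 1 + 3 / 16 * u := by positivity
          rw [mul_one_div, ← le_sub_iff_add_le, div_le_iff₀ this]
          nlinarith

lemma cavg_l2 (s : Finset ℕ) (u : ℕ → ℂ) (hu : ∀ k, ‖u k‖ = 1) (ν : ℕ → ℤ)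
    (hν : Function.Injective ν) :
    cavg (fun θ => ‖∑ k ∈ s, u k * cchar (-ν k) θ‖ ^ 2) = s.card := by
  have e : (fun θ => ‖∑ k ∈ s, u k * cchar (-ν k) θ‖ ^ 2) = fun θ =>
      (∑ k ∈ s, ∑ l ∈ s, (u k * (starRingEnd ℂ) (u l)) * cchar (ν l - ν k) θ).re := by
    funext θ
    rw [Complex.sq_norm, ← Complex.ofReal_re (Complex.normSq _), Complex.normSq_eq_conj_mul_self,
      mul_comm, map_sum, Finset.sum_mul_sum]
    congr 1
    refine Finset.sum_congr rfl fun k _ => Finset.sum_congr rfl fun l _ => ?_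
    rw [map_mul, cchar_conj, sub_eq_add_neg, cchar_add, neg_neg]
    ring
  rw [e, cavg_re (by fun_prop), cavg_sum _ (fun k _ => by fun_prop)]
  have : ∀ k ∈ s, cavg (fun θ => ∑ l ∈ s, (u k * (starRingEnd ℂ) (u l)) * cchar (ν l - ν k) θ) = 1 := by
    intro k hk
    rw [cavg_sum _ (fun l _ => by fun_prop), Finset.sum_eq_single k]
    · rw [cavg_mul_left, sub_self, cavg_char_zero, Complex.mul_conj, Complex.normSq_eq_norm_sq, hu]
      simp
    · intro l _ hl
      rw [cavg_mul_left, cavg_char (sub_ne_zero.mpr (hν.ne hl)), mul_zero]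
    · exact fun h => absurd hk h
  rw [Finset.sum_congr rfl this]
  simp

/-- block boundaries -/
def blk (l : ℕ) : ℕ := ∑ i ∈ Finset.range l, 4 ^ i

lemma blk_succ (l : ℕ) : blk (l + 1) = blk l + 4 ^ l := Finset.sum_range_succ _ _

lemma blk_mono : Monotone blk := monotone_nat_of_le_succ fun l => by rw [blk_succ]; exact Nat.le_add_right _ _

lemma cavg_err (f : ℕ → ℝ → ℂ) (g : ℕ → ℂ → ℂ) (hfc : ∀ j, Continuous (f j))
    (hg : ∀ j, Differentiable ℂ (g j))
    (hf2 : ∀ j, cavg (fun θ => ‖f j θ‖ ^ 2) ≤ (1 / 4) ^ j)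
    (hg2 : ∀ j, cavg (fun θ => ‖g j (cpt θ)‖ ^ 2) ≤ 4 * (1 / 4) ^ j)
    (h2 : ∀ j θ, ‖f j θ‖ ≤ (g j (cpt θ)).re) (j J : ℕ) :
    cavg (fun θ => ‖f j θ‖ *
      ‖Complex.exp (-(3 / 16 * ∑ i ∈ Finset.Ico (j + 1) J, g i (cpt θ))) - 1‖) ≤
      3 / 8 * (1 / 4) ^ j := by
  have hgc : ∀ j, Continuous (g j) := fun j => (hg j).continuous
  have hre : ∀ j θ, 0 ≤ (g j (cpt θ)).re := fun j θ => (norm_nonneg _).trans (h2 j θ)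
  have hone : ∀ i, cavg (fun θ => ‖f j θ‖ * ‖g i (cpt θ)‖) ≤ 2 * (1 / 2) ^ j * (1 / 2) ^ i := by
    intro i
    set A : ℝ := (1 / 2) ^ j with hA
    set B : ℝ := (1 / 2) ^ i with hB
    have hA0 : 0 < A := by positivity
    have hB0 : 0 < B := by positivity
    have hA2 : (1 / 4 : ℝ) ^ j = A ^ 2 := by rw [hA, ← pow_mul, mul_comm, pow_mul]; norm_num
    have hB2 : (1 / 4 : ℝ) ^ i = B ^ 2 := by rw [hB, ← pow_mul, mul_comm, pow_mul]; norm_num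
    have h3 := hf2 j
    have h4 := hg2 i
    rw [hA2] at h3
    rw [hB2] at h4
    have h5 : cavg (fun θ => ‖f j θ‖ * ‖g i (cpt θ)‖) ≤
        cavg (fun θ => (B / A) * ‖f j θ‖ ^ 2 + (A / (4 * B)) * ‖g i (cpt θ)‖ ^ 2) := by
      refine cavg_mono (by fun_prop) (by fun_prop) fun θ => ?_
      set x := ‖f j θ‖
      set y := ‖g i (cpt θ)‖
      have : (B / A) * x ^ 2 + (A / (4 * B)) * y ^ 2 - x * y =
          (2 * B * x - A * y) ^ 2 / (4 * A * B) := by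
        field_simp; ring
      have h6 : 0 ≤ (2 * B * x - A * y) ^ 2 / (4 * A * B) := by positivity
      linarith
    rw [cavg_add (by fun_prop) (by fun_prop), cavg_mul_left_real, cavg_mul_left_real] at h5
    calc _ ≤ _ := h5
      _ ≤ B / A * A ^ 2 + A / (4 * B) * (4 * B ^ 2) := by gcongr
      _ = 2 * A * B := by field_simp; ring
  calc _ ≤ cavg (fun θ => ∑ i ∈ Finset.Ico (j + 1) J, 3 / 16 * (‖f j θ‖ * ‖g i (cpt θ)‖)) := by
        refine cavg_mono (by fun_prop) (by fun_prop) fun θ => ?_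
        rw [← Finset.mul_sum, ← Finset.mul_sum]
        have h3 := norm_exp_neg_sub_one_le (z := 3 / 16 * ∑ i ∈ Finset.Ico (j + 1) J, g i (cpt θ)) (by
          have : (3 / 16 * ∑ i ∈ Finset.Ico (j + 1) J, g i (cpt θ)).re =
            3 / 16 * ∑ i ∈ Finset.Ico (j + 1) J, (g i (cpt θ)).re := by
            simp [Complex.mul_re]
          rw [this]
          exact mul_nonneg (by norm_num) (Finset.sum_nonneg fun i _ => hre i θ))
        have h4 := norm_sum_le (Finset.Ico (j + 1) J) (fun i => g i (cpt θ))
        have h5 : ‖Complex.exp (-(3 / 16 * ∑ i ∈ Finset.Ico (j + 1) J, g i (cpt θ))) - 1‖ ≤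
            3 / 16 * ∑ i ∈ Finset.Ico (j + 1) J, ‖g i (cpt θ)‖ := by
          refine h3.trans ?_
          rw [norm_mul]
          have : ‖(3 / 16 : ℂ)‖ = 3 / 16 := by norm_num
          rw [this]
          gcongr
        calc _ ≤ ‖f j θ‖ * (3 / 16 * ∑ i ∈ Finset.Ico (j + 1) J, ‖g i (cpt θ)‖) := by gcongr
          _ = _ := by ring
    _ = ∑ i ∈ Finset.Ico (j + 1) J, 3 / 16 * cavg (fun θ => ‖f j θ‖ * ‖g i (cpt θ)‖) := by
        rw [cavg_sum _ (fun i _ => by fun_prop)]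
        exact Finset.sum_congr rfl fun i _ => cavg_mul_left_real _ _
    _ ≤ ∑ i ∈ Finset.Ico (j + 1) J, 3 / 16 * (2 * (1 / 2) ^ j * (1 / 2) ^ i) := by
        gcongr with i _
        exact hone i
    _ = 3 / 8 * (1 / 2) ^ j * ∑ i ∈ Finset.Ico (j + 1) J, (1 / 2 : ℝ) ^ i := by
        rw [Finset.mul_sum]
        exact Finset.sum_congr rfl fun i _ => by ring
    _ ≤ 3 / 8 * (1 / 2) ^ j * ((1 / 2) ^ (j + 1) / (1 - 1 / 2)) := by
        gcongr
        exact geom_sum_Ico_le_of_lt_one (by norm_num) (by norm_num)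
    _ = 3 / 8 * (1 / 4) ^ j := by
        rw [show (1 / 4 : ℝ) = 1 / 2 * (1 / 2) by norm_num, mul_pow, pow_succ]; ring

theorem littlewood_bound (N J : ℕ) (hJ : blk J ≤ N) (ν : ℕ → ℤ) (hν : StrictMono ν) (c : ℕ → ℂ)
    (b : ℝ) (hc : ∀ k < N, b ≤ ‖c k‖) :
    3 / 38 * b * J ≤ cavg (fun θ => ‖∑ k ∈ Finset.range N, c k * cchar (ν k) θ‖) := by
  have hu : ∀ k, ∃ u : ℂ, ‖u‖ = 1 ∧ c k * u = ‖c k‖ := by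
    intro k
    by_cases h : c k = 0
    · exact ⟨1, by simp, by simp [h]⟩
    · have h' : (‖c k‖ : ℂ) ≠ 0 := by simpa using h
      refine ⟨(starRingEnd ℂ) (c k) / ‖c k‖, by simp [h], ?_⟩
      rw [mul_div_assoc', Complex.mul_conj', sq]
      field_simp
  choose u hu1 hu2 using hu
  let S : ℕ → Finset ℕ := fun j => Finset.Ico (blk j) (blk (j + 1))
  have hScard : ∀ j, (S j).card = 4 ^ j := fun j => by simp [S, blk_succ]
  let f : ℕ → ℝ → ℂ := fun j θ => (1 / 4 : ℂ) ^ j * ∑ k ∈ S j, u k * cchar (-ν k) θ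
  have hfc : ∀ j, Continuous (f j) := fun j => by simp only [f]; fun_prop
  have hn4 : ∀ j : ℕ, ‖(1 / 4 : ℂ) ^ j‖ = (1 / 4 : ℝ) ^ j := fun j => by simp
  have h44 : ∀ j : ℕ, (1 / 4 : ℝ) ^ j * 4 ^ j = 1 := fun j => by rw [← mul_pow]; norm_num
  have hf1 : ∀ j θ, ‖f j θ‖ ≤ 1 := by
    intro j θ
    simp only [f]
    rw [norm_mul, hn4]
    have : ‖∑ k ∈ S j, u k * cchar (-ν k) θ‖ ≤ 4 ^ j := by
      refine (norm_sum_le _ _).trans ?_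
      simp only [norm_mul, hu1, cchar_norm]
      simp [hScard]
    calc _ ≤ (1 / 4 : ℝ) ^ j * 4 ^ j := by gcongr
      _ = 1 := h44 j
  have hf2 : ∀ j, cavg (fun θ => ‖f j θ‖ ^ 2) ≤ (1 / 4) ^ j := by
    intro j
    simp only [f, norm_mul, hn4, mul_pow _ _ 2]
    rw [cavg_mul_left_real, cavg_l2 _ u hu1 ν hν.injective, hScard]
    push_cast
    rw [sq, mul_assoc, h44, mul_one]
  have hfp : ∀ j, Function.Periodic (f j) (2 * Real.pi) := by
    intro j θ
    simp only [f]
    congr 1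
    exact Finset.sum_congr rfl fun k _ => by rw [cchar_periodic]
  have hg : ∀ j, ∃ g : ℂ → ℂ, Differentiable ℂ g ∧ (∀ θ, ‖f j θ‖ ≤ (g (cpt θ)).re) ∧
      cavg (fun θ => ‖g (cpt θ)‖ ^ 2) ≤ 4 * (1 / 4) ^ j := fun j =>
    exists_majorant (hfc j) (hfp j) (hf1 j) (by positivity) (pow_le_one₀ (by norm_num) (by norm_num))
      (hf2 j)
  choose g hgd hg1 hg2 using hg
  have hgc : ∀ j, Continuous (g j) := fun j => (hgd j).continuous
  let X : ℕ → ℂ → ℂ := fun j z => Complex.exp (-(3 / 16 * ∑ i ∈ Finset.Ico (j + 1) J, g i z))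
  have hXd : ∀ j, Differentiable ℂ (X j) := fun j => by simp only [X]; fun_prop
  have hXc : ∀ j, Continuous (X j) := fun j => (hXd j).continuous
  let F : ℝ → ℂ := fun θ => ∑ j ∈ Finset.range J, f j θ * X j (cpt θ)
  have hFc : Continuous F := by simp only [F]; fun_prop
  have hF : ∀ θ, ‖F θ‖ ≤ 19 / 3 := fun θ => sum_exp_bounded f g hf1 hg1 J θ
  -- pairings
  let P : ℕ → ℤ → ℂ := fun j n => cavg (fun θ => cchar n θ * (f j θ * X j (cpt θ)))
  let Q : ℕ → ℤ → ℂ := fun j n => cavg (fun θ => cchar n θ * f j θ)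
  have hP0 : ∀ j k, blk (j + 1) ≤ k → P j (ν k) = 0 := by
    intro j k hk
    have e : (fun θ => cchar (ν k) θ * (f j θ * X j (cpt θ))) = fun θ =>
        ∑ l ∈ S j, ((1 / 4 : ℂ) ^ j * u l) * (cchar (ν k - ν l) θ * X j (cpt θ)) := by
      funext θ
      simp only [f]
      rw [Finset.mul_sum, Finset.sum_mul, Finset.mul_sum]
      refine Finset.sum_congr rfl fun l _ => ?_
      rw [sub_eq_add_neg, cchar_add]; ring
    simp only [P]
    rw [e, cavg_sum _ (fun l _ => by fun_prop)]
    refine Finset.sum_eq_zero fun l hl => ?_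
    have : l < k := lt_of_lt_of_le (Finset.mem_Ico.mp hl).2 hk
    rw [cavg_mul_left, cavg_char_analytic (hXd j) (sub_pos.mpr (hν this)), mul_zero]
  have hQ : ∀ j k, Q j (ν k) = if k ∈ S j then (1 / 4 : ℂ) ^ j * u k else 0 := by
    intro j k
    have e : (fun θ => cchar (ν k) θ * f j θ) = fun θ =>
        ∑ l ∈ S j, ((1 / 4 : ℂ) ^ j * u l) * cchar (ν k - ν l) θ := by
      funext θ
      simp only [f]
      rw [Finset.mul_sum, Finset.mul_sum]
      refine Finset.sum_congr rfl fun l _ => ?_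
      rw [sub_eq_add_neg, cchar_add]; ring
    simp only [Q]
    rw [e, cavg_sum _ (fun l _ => by fun_prop)]
    rw [← Finset.sum_ite_eq (S j) k (fun l => (1 / 4 : ℂ) ^ j * u l)]
    refine Finset.sum_congr rfl fun l _ => ?_
    rw [cavg_mul_left]
    split_ifs with h
    · rw [h, sub_self, cavg_char_zero, mul_one]
    · rw [cavg_char (sub_ne_zero.mpr (hν.injective.ne h)), mul_zero]
  have hPQ : ∀ j n, ‖P j n - Q j n‖ ≤ 3 / 8 * (1 / 4) ^ j := by
    intro j n
    simp only [P, Q]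
    rw [← cavg_sub (by fun_prop) (by fun_prop)]
    refine (cavg_norm_le _).trans ?_
    refine le_of_eq_of_le ?_ (cavg_err f g hfc hgd hf2 hg2 hg1 j J)
    congr 1
    funext θ
    rw [← mul_sub, norm_mul, cchar_norm, one_mul, ← norm_mul]
    simp only [X]
    ring_nf
  have hblock : ∀ l < J, ∀ k ∈ S l, b * (1 / 4) ^ l / 2 ≤
      (c k * ∑ j ∈ Finset.range J, P j (ν k)).re := by
    intro l hl k hk
    have hk' := Finset.mem_Ico.mp hk
    have hkN : k < N := lt_of_lt_of_le hk'.2 ((blk_mono (by omega)).trans hJ)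
    have hQs : ∑ j ∈ Finset.range J, Q j (ν k) = (1 / 4 : ℂ) ^ l * u k := by
      rw [Finset.sum_eq_single l]
      · rw [hQ, if_pos hk]
      · intro j _ hj
        rw [hQ, if_neg]
        intro hkj
        have hkj' := Finset.mem_Ico.mp hkj
        rcases lt_or_gt_of_ne hj with h | h
        · have := blk_mono (show j + 1 ≤ l by omega); omega
        · have := blk_mono (show l + 1 ≤ j by omega); omega
      · intro h; exact absurd (Finset.mem_range.mpr hl) h
    have hD : ‖∑ j ∈ Finset.range J, (P j (ν k) - Q j (ν k))‖ ≤ (1 / 4) ^ l / 2 := by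
      have hz : ∑ j ∈ Finset.range J, (P j (ν k) - Q j (ν k)) =
          ∑ j ∈ Finset.Ico l J, (P j (ν k) - Q j (ν k)) := by
        rw [Finset.range_eq_Ico, ← Finset.sum_Ico_consecutive _ (Nat.zero_le l) hl.le,
          Finset.sum_eq_zero, zero_add]
        intro j hj
        have hj' := (Finset.mem_Ico.mp hj).2
        have hbj := blk_mono (show j + 1 ≤ l by omega)
        rw [hP0 j k (by omega), hQ, if_neg, sub_zero]
        intro hkj
        have := Finset.mem_Ico.mp hkj
        omega
      rw [hz]
      calc _ ≤ ∑ j ∈ Finset.Ico l J, 3 / 8 * (1 / 4 : ℝ) ^ j :=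
            (norm_sum_le _ _).trans (Finset.sum_le_sum fun j _ => hPQ j _)
        _ = 3 / 8 * ∑ j ∈ Finset.Ico l J, (1 / 4 : ℝ) ^ j := by rw [Finset.mul_sum]
        _ ≤ 3 / 8 * ((1 / 4) ^ l / (1 - 1 / 4)) := by
            gcongr
            exact geom_sum_Ico_le_of_lt_one (by norm_num) (by norm_num)
        _ = _ := by ring
    rw [Finset.sum_sub_distrib, hQs] at hD
    set Z := ∑ j ∈ Finset.range J, P j (ν k)
    have e : c k * Z = ((‖c k‖ * (1 / 4) ^ l : ℝ) : ℂ) + c k * (Z - (1 / 4 : ℂ) ^ l * u k) := by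
      push_cast
      rw [← hu2 k]; ring
    rw [e, Complex.add_re, Complex.ofReal_re]
    have h1 := (abs_le.mp (Complex.abs_re_le_norm (c k * (Z - (1 / 4 : ℂ) ^ l * u k)))).1
    rw [norm_mul] at h1
    have h2 : ‖c k‖ * ‖Z - (1 / 4 : ℂ) ^ l * u k‖ ≤ ‖c k‖ * ((1 / 4) ^ l / 2) := by gcongr
    have h3 := mul_le_mul_of_nonneg_right (hc k hkN) (show (0 : ℝ) ≤ (1 / 4) ^ l by positivity)
    linarith
  have htot : ∀ L ≤ J, b / 2 * L ≤
      (∑ k ∈ Finset.range (blk L), c k * ∑ j ∈ Finset.range J, P j (ν k)).re := by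
    intro L
    induction L with
    | zero => intro _; simp [blk]
    | succ L ih =>
      intro hL
      have h1 := ih (by omega)
      rw [Finset.range_eq_Ico, ← Finset.sum_Ico_consecutive _ (Nat.zero_le (blk L))
        (blk_mono (Nat.le_succ L)), ← Finset.range_eq_Ico, Complex.add_re]
      have h2 : b / 2 ≤ (∑ k ∈ S L, c k * ∑ j ∈ Finset.range J, P j (ν k)).re := by
        rw [Complex.re_sum]
        calc b / 2 = ∑ k ∈ S L, b * (1 / 4) ^ L / 2 := by
              rw [Finset.sum_const, hScard, nsmul_eq_mul]
              push_cast
              have := h44 L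
              linear_combination (-b / 2) * this
          _ ≤ _ := Finset.sum_le_sum fun k hk => hblock L (by omega) k hk
      push_cast
      simp only [S] at h2
      linarith
  have hpair : cavg (fun θ => (∑ k ∈ Finset.range N, c k * cchar (ν k) θ) * F θ) =
      ∑ k ∈ Finset.range N, c k * ∑ j ∈ Finset.range J, P j (ν k) := by
    have e : (fun θ => (∑ k ∈ Finset.range N, c k * cchar (ν k) θ) * F θ) = fun θ =>
        ∑ k ∈ Finset.range N, c k * ∑ j ∈ Finset.range J, cchar (ν k) θ * (f j θ * X j (cpt θ)) := by
      funext θ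
      rw [Finset.sum_mul]
      refine Finset.sum_congr rfl fun k _ => ?_
      rw [mul_assoc]
      simp only [F]
      rw [Finset.mul_sum]
    rw [e, cavg_sum _ (fun k _ => by fun_prop)]
    refine Finset.sum_congr rfl fun k _ => ?_
    rw [cavg_mul_left, cavg_sum _ (fun k _ => by fun_prop)]
  have htail : ∑ k ∈ Finset.range N, c k * ∑ j ∈ Finset.range J, P j (ν k) =
      ∑ k ∈ Finset.range (blk J), c k * ∑ j ∈ Finset.range J, P j (ν k) := by
    symm
    refine Finset.sum_subset (Finset.range_mono hJ) fun k _ hk => ?_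
    rw [Finset.mem_range, not_lt] at hk
    rw [Finset.sum_eq_zero, mul_zero]
    intro j hj
    rw [Finset.mem_range] at hj
    exact hP0 j k ((blk_mono (show j + 1 ≤ J by omega)).trans hk)
  have hlow := htot J le_rfl
  rw [← htail, ← hpair] at hlow
  have hup : (cavg (fun θ => (∑ k ∈ Finset.range N, c k * cchar (ν k) θ) * F θ)).re ≤
      19 / 3 * cavg (fun θ => ‖∑ k ∈ Finset.range N, c k * cchar (ν k) θ‖) := by
    refine (Complex.re_le_norm _).trans ((cavg_norm_le _).trans ?_)
    rw [← cavg_mul_left_real]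
    refine cavg_mono (by fun_prop) (by fun_prop) fun θ => ?_
    rw [norm_mul, mul_comm]
    gcongr
    exact hF θ
  linarith

lemma exists_blk {N : ℕ} (hN : 1 ≤ N) : ∃ J, blk J ≤ N ∧ Real.log N ≤ 2 * J := by
  have h3 : ∀ l, 3 * blk l + 1 = 4 ^ l := by
    intro l
    induction l with
    | zero => simp [blk]
    | succ l ih => rw [blk_succ, pow_succ]; omega
  have hex : ∃ J, N < blk J := by
    refine ⟨N + 1, ?_⟩
    have h1 := h3 (N + 1)
    have h2 : N + 1 < 2 ^ (N + 1) := Nat.lt_two_pow_self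
    have h4 : (4 : ℕ) ^ (N + 1) = 2 ^ (N + 1) * 2 ^ (N + 1) := by rw [← mul_pow]; norm_num
    nlinarith
  classical
  have hs := Nat.find_spec hex
  have hmin := fun k => Nat.find_min hex (m := k)
  set L := Nat.find hex
  have hL2 : 2 ≤ L := by
    by_contra h
    have h5 : blk L ≤ blk 1 := blk_mono (by omega)
    have h6 := h3 1
    omega
  obtain ⟨K, hK⟩ : ∃ K, L = K + 2 := ⟨L - 2, by omega⟩
  refine ⟨K + 1, not_lt.mp (hmin (K + 1) (by omega)), ?_⟩
  have h7 := h3 L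
  have h8 : 3 * N ≤ 4 ^ (K + 2) := by rw [← hK]; omega
  have h9 : (N : ℝ) ≤ 16 / 3 * 4 ^ K := by
    have : (3 * N : ℝ) ≤ 4 ^ (K + 2) := by exact_mod_cast h8
    rw [pow_add] at this
    linarith
  have h10 : (16 / 3 : ℝ) ≤ Real.exp 2 := by
    have := Real.exp_one_gt_d9
    have e : Real.exp 2 = Real.exp 1 * Real.exp 1 := by rw [← Real.exp_add]; norm_num
    rw [e]; nlinarith
  have hpos : (0 : ℝ) < N := by exact_mod_cast hN
  rw [Real.log_le_iff_le_exp hpos]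
  calc (N : ℝ) ≤ 16 / 3 * 4 ^ K := h9
    _ ≤ Real.exp 2 * (Real.exp 2) ^ K := by gcongr; linarith
    _ = _ := by rw [← Real.exp_nat_mul, ← Real.exp_add]; congr 1; push_cast; ring

theorem littlewood_fintype {ι : Type*} [Fintype ι] [Nonempty ι] (φ : ι → ℤ)
    (hφ : Function.Injective φ) (d : ι → ℂ) (b : ℝ) (hb : 0 ≤ b) (hd : ∀ i, b ≤ ‖d i‖) :
    3 / 76 * b * Real.log (Fintype.card ι) ≤ cavg (fun θ => ‖∑ i, d i * cchar (φ i) θ‖) := by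
  set N := Fintype.card ι with hN
  obtain ⟨J, hJ, hlog⟩ := exists_blk (N := N) (Fintype.card_pos)
  let e0 : Fin N ≃ ι := (Fintype.equivFin ι).symm
  let e : Fin N ≃ ι := (Tuple.sort (φ ∘ e0)).trans e0
  have hmono : StrictMono (φ ∘ e) :=
    (Tuple.monotone_sort (φ ∘ e0)).strictMono_of_injective (hφ.comp e.injective)
  let M : ℤ := ∑ i, |φ i|
  have hM : ∀ i, φ i ≤ M := fun i => (le_abs_self _).trans
    (Finset.single_le_sum (f := fun i => |φ i|) (fun _ _ => abs_nonneg _) (Finset.mem_univ i))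
  let ν : ℕ → ℤ := fun k => if h : k < N then φ (e ⟨k, h⟩) else M + 1 + k
  have hν : StrictMono ν := by
    intro i j hij
    simp only [ν]
    split_ifs with h1 h2 h2
    · exact hmono (show (⟨i, h1⟩ : Fin N) < ⟨j, h2⟩ from hij)
    · have := hM (e ⟨i, h1⟩); omega
    · omega
    · omega
  let c : ℕ → ℂ := fun k => if h : k < N then d (e ⟨k, h⟩) else 0
  have key := littlewood_bound N J hJ ν hν c b (fun k hk => by simp only [c, dif_pos hk]; exact hd _)
  have hsum : ∀ θ, ∑ k ∈ Finset.range N, c k * cchar (ν k) θ = ∑ i, d i * cchar (φ i) θ := by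
    intro θ
    rw [Finset.sum_range, ← e.sum_comp]
    refine Finset.sum_congr rfl fun k _ => ?_
    simp [c, ν]
  simp only [hsum] at key
  refine le_trans ?_ key
  have := mul_le_mul_of_nonneg_left hlog hb
  linarith

theorem cos_int_bound (s : Finset ℕ) (hs : s.Nonempty) (n : ℕ → ℤ) (b : ℕ → ℝ)
    (hinj : ∀ i ∈ s, ∀ j ∈ s, n i = n j → i = j) (hadd : ∀ i ∈ s, ∀ j ∈ s, n i + n j ≠ 0)
    (B A : ℝ) (hB : 0 ≤ B) (hbB : ∀ j ∈ s, B ≤ |b j|)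
    (hA : ∀ t : ℝ, -A ≤ ∑ j ∈ s, b j * Real.cos (n j * t)) :
    3 / 304 * B * Real.log (2 * s.card) ≤ A := by
  have : Nonempty s := hs.to_subtype
  have hcos : ∀ (k : ℤ) (t : ℝ), ((Real.cos (k * t) : ℝ) : ℂ) = (cchar k t + cchar (-k) t) / 2 := by
    intro k t
    rw [Complex.ofReal_cos, Complex.cos]
    simp only [cchar]
    push_cast
    ring_nf
  let φ : s ⊕ s → ℤ := Sum.elim (fun i => n i) (fun i => - n i)
  let d : s ⊕ s → ℂ := Sum.elim (fun i => (b i : ℂ) / 2) (fun i => (b i : ℂ) / 2)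
  have hφ : Function.Injective φ := by
    rintro (⟨i, hi⟩ | ⟨i, hi⟩) (⟨j, hj⟩ | ⟨j, hj⟩) h <;> simp only [φ, Sum.elim_inl, Sum.elim_inr] at h
    · simp [hinj i hi j hj h]
    · exact absurd (by omega) (hadd i hi j hj)
    · exact absurd (by omega) (hadd i hi j hj)
    · simp [hinj i hi j hj (by omega)]
  have key := littlewood_fintype φ hφ d (B / 2) (by positivity) (by
    rintro (⟨i, hi⟩ | ⟨i, hi⟩) <;>
    · simp only [d, Sum.elim_inl, Sum.elim_inr, norm_div, Complex.norm_real, Real.norm_eq_abs]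
      have := hbB i hi
      norm_num
      linarith)
  have hG : ∀ θ, ∑ i, d i * cchar (φ i) θ = ((∑ j ∈ s, b j * Real.cos (n j * θ) : ℝ) : ℂ) := by
    intro θ
    rw [Fintype.sum_sum_type]
    simp only [d, φ, Sum.elim_inl, Sum.elim_inr]
    rw [← Finset.sum_add_distrib, Finset.sum_coe_sort s
      (fun i => (b i : ℂ) / 2 * cchar (n i) θ + (b i : ℂ) / 2 * cchar (-n i) θ), Complex.ofReal_sum]
    refine Finset.sum_congr rfl fun i _ => ?_
    rw [Complex.ofReal_mul, hcos]; ring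
  simp only [hG, Complex.norm_real, Real.norm_eq_abs] at key
  have hc : Continuous (fun θ : ℝ => ∑ j ∈ s, b j * Real.cos (n j * θ)) := by fun_prop
  have hzero : cavg (fun θ => ∑ j ∈ s, b j * Real.cos (n j * θ)) = 0 := by
    rw [cavg_sum _ (fun j _ => by fun_prop)]
    refine Finset.sum_eq_zero fun j hj => ?_
    have hnj : n j ≠ 0 := by have := hadd j hj j hj; omega
    rw [cavg_mul_left_real]
    have e : (fun θ : ℝ => Real.cos (n j * θ)) = fun θ => (cchar (n j) θ).re := by
      funext θ
      have : cchar (n j) θ = Complex.exp (((n j * θ : ℝ) : ℂ) * Complex.I) := by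
        simp only [cchar]; push_cast; ring_nf
      rw [this, Complex.exp_ofReal_mul_I_re]
    rw [e, cavg_re (by fun_prop), cavg_char hnj]
    simp
  have hA0 : 0 ≤ A := by
    have := cavg_mono (F := fun _ => -A) (by fun_prop) hc hA
    rw [cavg_const, hzero] at this
    linarith
  have hle : cavg (fun θ => |∑ j ∈ s, b j * Real.cos (n j * θ)|) ≤
      cavg (fun θ => (∑ j ∈ s, b j * Real.cos (n j * θ)) + 2 * A) := by
    refine cavg_mono (by fun_prop) (by fun_prop) fun θ => ?_
    have := hA θ
    rw [abs_le]
    constructor <;> linarith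
  rw [cavg_add hc (by fun_prop), hzero, cavg_const] at hle
  have hcard : (Fintype.card (s ⊕ s) : ℝ) = 2 * s.card := by
    simp [Fintype.card_sum]; ring
  rw [hcard] at key
  linarith

lemma frequently_near_int (s : Finset ℕ) (x : ℕ → ℝ) {ε : ℝ} (hε : 0 < ε) :
    ∃ᶠ q : ℕ in Filter.atTop, ∀ j ∈ s, ∃ p : ℤ, |q * x j - p| < ε := by
  let y : Multiplicative (s → UnitAddCircle) := Multiplicative.ofAdd fun j => (x j : UnitAddCircle)
  have h := mapClusterPt_one_atTop_pow y
  have hU : {z : Multiplicative (s → UnitAddCircle) | ‖Multiplicative.toAdd z‖ < ε} ∈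
      nhds (1 : Multiplicative (s → UnitAddCircle)) := by
    have : Metric.ball (0 : s → UnitAddCircle) ε ∈ nhds (0 : s → UnitAddCircle) :=
      Metric.ball_mem_nhds _ hε
    have e : Metric.ball (0 : s → UnitAddCircle) ε = {z | ‖z‖ < ε} := by
      ext z
      simp [Metric.mem_ball]
    rw [e] at this
    exact this
  refine (h.frequently hU).mono fun q hq j hj => ?_
  refine ⟨round (q * x j), ?_⟩
  rw [← UnitAddCircle.norm_eq]
  have h1 := (norm_le_pi_norm (Multiplicative.toAdd (y ^ q)) ⟨j, hj⟩).trans_lt hq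
  simpa [y] using h1

/-- **Corollary 5 (Beukers–Tijdeman): non-degenerate cosine sums.**
Let `b 1, …, b m` be nonzero reals and `α 1, …, α m` distinct reals strictly between `0`
and `1/2` such that no difference `α i - α j` with `i ≠ j` and no sum `α i + α j`
(including `i = j`) is rational.  Then
`inf_{k ∈ ℤ} ∑ j, b j * cos (2π α j k) < -(log (2m)/(2π⁴)) min_j |b j|`. -/
theorem one_sided_cosine_sum_nondegenerate
    (m : ℕ) (hm : 1 ≤ m) (b α : ℕ → ℝ)
    (hb0 : ∀ j ∈ Finset.Icc 1 m, b j ≠ 0)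
    (hα : ∀ j ∈ Finset.Icc 1 m, 0 < α j ∧ α j < 1 / 2)
    (hαdist : Set.InjOn α (Set.Icc 1 m))
    (hdiff : ∀ i ∈ Finset.Icc 1 m, ∀ j ∈ Finset.Icc 1 m, i ≠ j → Irrational (α i - α j))
    (hsum : ∀ i ∈ Finset.Icc 1 m, ∀ j ∈ Finset.Icc 1 m, Irrational (α i + α j)) :
    (⨅ k : ℤ, ∑ j ∈ Finset.Icc 1 m, b j * Real.cos (2 * Real.pi * α j * k)) <
      -(Real.log (2 * m) / (2 * Real.pi ^ 4)) *
        ((Finset.Icc 1 m).inf' (Finset.nonempty_Icc.mpr hm) (fun j => |b j|)) := by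
  set s := Finset.Icc 1 m with hs
  have hne : s.Nonempty := Finset.nonempty_Icc.mpr hm
  set B := s.inf' (Finset.nonempty_Icc.mpr hm) (fun j => |b j|) with hBdef
  have hB : 0 < B := by
    rw [hBdef, Finset.lt_inf'_iff]
    exact fun j hj => abs_pos.mpr (hb0 j hj)
  have hbB : ∀ j ∈ s, B ≤ |b j| := fun j hj => Finset.inf'_le _ hj
  have hlog : 0 < Real.log (2 * m) := by
    apply Real.log_pos
    have : (1 : ℝ) ≤ m := by exact_mod_cast hm
    linarith
  set T := Real.log (2 * m) / (2 * Real.pi ^ 4) * B with hT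
  have hT0 : 0 < T := by positivity
  by_contra hcon
  rw [not_lt, neg_mul] at hcon
  set W := ∑ j ∈ s, |b j| with hW
  have hW0 : 0 < W := Finset.sum_pos (fun j hj => abs_pos.mpr (hb0 j hj)) hne
  have hbdd : BddBelow (Set.range fun k : ℤ => ∑ j ∈ s, b j * Real.cos (2 * Real.pi * α j * k)) := by
    refine ⟨-W, ?_⟩
    rintro _ ⟨k, rfl⟩
    simp only
    rw [hW, ← Finset.sum_neg_distrib]
    refine Finset.sum_le_sum fun j _ => ?_
    have h1 := abs_le.mp (show |b j * Real.cos (2 * Real.pi * α j * k)| ≤ |b j| by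
      rw [abs_mul]
      exact mul_le_of_le_one_right (abs_nonneg _) (Real.abs_cos_le_one _))
    exact h1.1
  have hall : ∀ k : ℤ, -T ≤ ∑ j ∈ s, b j * Real.cos (2 * Real.pi * α j * k) :=
    fun k => hcon.trans (ciInf_le hbdd k)
  -- choice of the tolerance
  obtain ⟨η, hη0, hη1, hη2⟩ : ∃ η : ℝ, 0 < η ∧ η ≤ 1 / 2 ∧ W * (4 * Real.pi * η) ≤ T / 2 := by
    refine ⟨min (1 / 2) (T / 2 / (W * (4 * Real.pi))), by positivity, min_le_left _ _, ?_⟩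
    have h1 : min (1 / 2) (T / 2 / (W * (4 * Real.pi))) ≤ T / 2 / (W * (4 * Real.pi)) := min_le_right _ _
    rw [le_div_iff₀ (by positivity)] at h1
    linarith
  -- first recurrence
  obtain ⟨q, hq, hq0⟩ := ((frequently_near_int s α hη0).and_eventually
    (Filter.eventually_gt_atTop 0)).exists
  have hqR : (q : ℝ) ≠ 0 := by exact_mod_cast hq0.ne'
  choose! p hp using hq
  let δ : ℕ → ℝ := fun j => q * α j - p j
  have hδsub : ∀ i ∈ s, ∀ j ∈ s, i ≠ j → δ i - δ j ≠ 0 := by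
    intro i hi j hj hij h
    refine hdiff i hi j hj hij ⟨((p i - p j : ℤ) : ℚ) / (q : ℚ), ?_⟩
    push_cast
    rw [div_eq_iff hqR]
    simp only [δ] at h
    linarith
  have hδadd : ∀ i ∈ s, ∀ j ∈ s, δ i + δ j ≠ 0 := by
    intro i hi j hj h
    refine hsum i hi j hj ⟨((p i + p j : ℤ) : ℚ) / (q : ℚ), ?_⟩
    push_cast
    rw [div_eq_iff hqR]
    simp only [δ] at h
    linarith
  -- second recurrence
  have hev : ∀ x : ℝ, x ≠ 0 → ∀ᶠ Q : ℕ in Filter.atTop, 1 < Q * |x| := by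
    intro x hx
    have h1 : Filter.Tendsto (fun Q : ℕ => (Q : ℝ) * |x|) Filter.atTop Filter.atTop :=
      tendsto_natCast_atTop_atTop.atTop_mul_const (abs_pos.mpr hx)
    exact h1.eventually_gt_atTop 1
  have hev1 : ∀ᶠ Q : ℕ in Filter.atTop, ∀ i ∈ s, ∀ j ∈ s, i ≠ j → 1 < Q * |δ i - δ j| := by
    rw [Filter.eventually_all_finset]
    intro i hi
    rw [Filter.eventually_all_finset]
    intro j hj
    by_cases hij : i = j
    · exact Filter.Eventually.of_forall fun _ h => absurd hij h
    · exact (hev _ (hδsub i hi j hj hij)).mono fun _ h _ => h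
  have hev2 : ∀ᶠ Q : ℕ in Filter.atTop, ∀ i ∈ s, ∀ j ∈ s, 1 < Q * |δ i + δ j| := by
    rw [Filter.eventually_all_finset]
    intro i hi
    rw [Filter.eventually_all_finset]
    intro j hj
    exact hev _ (hδadd i hi j hj)
  obtain ⟨Q, hQ, hQ1, hQ2⟩ := ((frequently_near_int s δ hη0).and_eventually
    (hev1.and hev2)).exists
  choose! n hn using hQ
  have hQ0 : (0 : ℝ) ≤ Q := Nat.cast_nonneg Q
  have hfin := cos_int_bound s hne n b
    (by
      intro i hi j hj hij
      by_contra hne'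
      have h1 := hQ1 i hi j hj hne'
      have h2 := hn i hi
      have h3 := hn j hj
      rw [← hij] at h3
      rw [← abs_of_nonneg hQ0, ← abs_mul] at h1
      have h4 : (Q : ℝ) * (δ i - δ j) = (Q * δ i - n i) - (Q * δ j - n i) := by ring
      rw [h4] at h1
      have h5 := abs_sub (Q * δ i - n i) (Q * δ j - n i)
      linarith)
    (by
      intro i hi j hj hij
      have h1 := hQ2 i hi j hj
      have h2 := hn i hi
      have h3 := hn j hj
      have hij' : (n i : ℝ) + n j = 0 := by exact_mod_cast hij
      rw [← abs_of_nonneg hQ0, ← abs_mul] at h1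
      have h4 : (Q : ℝ) * (δ i + δ j) = (Q * δ i - n i) + (Q * δ j - n j) := by linear_combination hij'
      rw [h4] at h1
      have h5 := abs_add_le (Q * δ i - n i) (Q * δ j - n j)
      linarith)
    B (3 / 2 * T) hB.le hbB
    (by
      intro t
      -- reduce to `x ∈ [0, 1)`
      set x := Int.fract (t / (2 * Real.pi)) with hx
      have hx0 : 0 ≤ x := Int.fract_nonneg _
      have hx1 : x < 1 := Int.fract_lt_one _
      have hcosx : ∀ j, Real.cos (n j * t) = Real.cos (2 * Real.pi * (n j * x)) := by
        intro j
        have hpi := Real.pi_pos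
        have e : (n j : ℝ) * t = 2 * Real.pi * (n j * x) +
            ((n j * ⌊t / (2 * Real.pi)⌋ : ℤ) : ℝ) * (2 * Real.pi) := by
          have h1 := Int.floor_add_fract (t / (2 * Real.pi))
          rw [← hx, eq_div_iff (by positivity)] at h1
          push_cast
          linear_combination (-(n j : ℝ)) * h1
        rw [e, Real.cos_add_int_mul_two_pi]
      set N : ℤ := ⌊x * Q⌋ with hN
      have hN1 : (N : ℝ) ≤ x * Q := Int.floor_le _
      have hN2 : x * Q < N + 1 := Int.lt_floor_add_one _
      have hk := hall (q * N)
      have hcosk : ∀ j, Real.cos (2 * Real.pi * α j * ((q * N : ℤ) : ℝ)) =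
          Real.cos (2 * Real.pi * (δ j * N)) := by
        intro j
        have e : 2 * Real.pi * α j * ((q * N : ℤ) : ℝ) = 2 * Real.pi * (δ j * N) +
            ((p j * N : ℤ) : ℝ) * (2 * Real.pi) := by
          simp only [δ]
          push_cast
          ring
        rw [e, Real.cos_add_int_mul_two_pi]
      simp only [hcosk] at hk
      simp only [hcosx]
      have hdiffj : ∀ j ∈ s, b j * Real.cos (2 * Real.pi * (δ j * N)) -
          b j * Real.cos (2 * Real.pi * (n j * x)) ≤ |b j| * (4 * Real.pi * η) := by
        intro j hj
        rw [← mul_sub]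
        refine (le_abs_self _).trans ?_
        rw [abs_mul]
        refine mul_le_mul_of_nonneg_left ?_ (abs_nonneg _)
        refine (Real.abs_cos_sub_cos_le _ _).trans ?_
        rw [← mul_sub, abs_mul, abs_of_pos (by positivity)]
        have h1 : |δ j * N - n j * x| ≤ 2 * η := by
          have e : δ j * N - n j * x = δ j * (N - x * Q) + x * (Q * δ j - n j) := by ring
          rw [e]
          refine (abs_add_le _ _).trans ?_
          rw [abs_mul, abs_mul, abs_of_nonneg hx0]
          have h2 : |(N : ℝ) - x * Q| ≤ 1 := abs_le.mpr ⟨by linarith, by linarith⟩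
          have h3 : |δ j| < η := hp j hj
          have h4 := hn j hj
          have h5 := mul_le_mul h3.le h2 (abs_nonneg _) hη0.le
          have h6 := mul_le_mul hx1.le h4.le (abs_nonneg _) (by norm_num)
          linarith
        nlinarith [Real.pi_pos]
      have hS := Finset.sum_le_sum hdiffj
      rw [Finset.sum_sub_distrib, ← Finset.sum_mul] at hS
      linarith)
  have hcard : (s.card : ℝ) = m := by simp [hs]
  rw [hcard] at hfin
  have hpi4 : (81 : ℝ) ≤ Real.pi ^ 4 := by
    have h3 : (3 : ℝ) ^ 4 ≤ Real.pi ^ 4 := by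
      have := Real.pi_gt_three
      gcongr
    linarith
  have hTle : T ≤ 1 / 162 * (B * Real.log (2 * m)) := by
    rw [hT, div_mul_eq_mul_div, div_le_iff₀ (by positivity)]
    have : 0 < B * Real.log (2 * m) := by positivity
    nlinarith
  have : 0 < B * Real.log (2 * m) := by positivity
  nlinarith
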